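/- Let k* = (1/2)·arccos(−γ₁/γ₀) if |γ₀| > |γ₁| and k* = (1/2)·arccos(−γ₀/γ₁) if |γ₀| < |γ₁|, and let ξ ∈ {0,1} satisfy |γ_ξ| = min{|γ₀|, |γ₁|}. Then k* ∈ (0, π/2), k* is the unique zero of h' in the open interval (0, π/2), and h(k*) = 2|γ_ξ| if γ₀γ₁ > 0 while h(k*) = −2|γ_ξ| if γ₀γ₁ < 0. -/

import Mathlib

open Real

theorem sq_add_sq_add_two_mul_cos_pos {a b : ℝ} (hab : |b| < |a|) (x : ℝ) :
    0 < a ^ 2 + b ^ 2 + 2 * a * b * cos x := by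
  have hsq : b ^ 2 < a ^ 2 := sq_lt_sq.2 hab
  have hsc := sin_sq_add_cos_sq x
  have hne : a + b * cos x ≠ 0 := by
    intro h0
    have h1 : a ^ 2 = b ^ 2 * cos x ^ 2 := by linear_combination (a - b * cos x) * h0
    nlinarith [mul_nonneg (sq_nonneg b) (sq_nonneg (sin x))]
  have : 0 < (a + b * cos x) ^ 2 := by positivity
  nlinarith [mul_nonneg (sq_nonneg b) (sq_nonneg (sin x))]

theorem hasDerivAt_sin_div_sqrt {a b : ℝ} (hab : |b| < |a|) (k : ℝ) :
    HasDerivAt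
      (fun k => 2 * a * b * sin (2 * k) / √(a ^ 2 + b ^ 2 + 2 * a * b * cos (2 * k)))
      (4 * a * b * ((a * cos (2 * k) + b) * (b * cos (2 * k) + a)) /
        √(a ^ 2 + b ^ 2 + 2 * a * b * cos (2 * k)) ^ 3) k := by
  have hg := sq_add_sq_add_two_mul_cos_pos hab (2 * k)
  have hsqrt := sqrt_pos.2 hg
  have hlin : HasDerivAt (fun k : ℝ => 2 * k) 2 k := by
    simpa using (hasDerivAt_id k).const_mul (2 : ℝ)
  have hnum := hlin.sin.const_mul (2 * a * b)
  have hden := ((hlin.cos.const_mul (2 * a * b)).const_add (a ^ 2 + b ^ 2)).sqrt hg.ne'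
  refine (hnum.div hden hsqrt.ne').congr_deriv ?_
  have hs := sq_sqrt hg.le
  set r := √(a ^ 2 + b ^ 2 + 2 * a * b * cos (2 * k))
  have hsc := sin_sq_add_cos_sq (2 * k)
  field_simp
  linear_combination (4 * a * b * cos (2 * k)) * hs + 4 * a ^ 2 * b ^ 2 * hsc

theorem deriv_sin_div_sqrt_eq_zero_iff {a b : ℝ} (hb : b ≠ 0) (hab : |b| < |a|) (k : ℝ) :
    deriv (fun k => 2 * a * b * sin (2 * k) / √(a ^ 2 + b ^ 2 + 2 * a * b * cos (2 * k))) k = 0 ↔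
      cos (2 * k) = -(b / a) := by
  have ha : a ≠ 0 := abs_pos.1 ((abs_nonneg b).trans_lt hab)
  have hr := (sqrt_pos.2 (sq_add_sq_add_two_mul_cos_pos hab (2 * k))).ne'
  have hne : b * cos (2 * k) + a ≠ 0 := by
    intro h0
    have h1 : |a| = |b| * |cos (2 * k)| := by
      rw [← abs_mul, ← abs_neg a]; congr 1; linarith
    nlinarith [abs_cos_le_one (2 * k), abs_nonneg b]
  rw [(hasDerivAt_sin_div_sqrt hab k).deriv]
  have h3 : a * cos (2 * k) + b = 0 ↔ cos (2 * k) = -(b / a) := by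
    rw [← neg_div, eq_div_iff ha]
    constructor <;> intro h <;> linarith
  simp [ha, hb, hr, hne, h3]

theorem half_arccos_critical {a b : ℝ} (hb : b ≠ 0) (hab : |b| < |a|) {k₀ : ℝ}
    (hk₀ : k₀ = 1 / 2 * arccos (-(b / a))) {h : ℝ → ℝ}
    (hh : ∀ k, h k = 2 * a * b * sin (2 * k) / √(a ^ 2 + b ^ 2 + 2 * a * b * cos (2 * k))) :
    k₀ ∈ Set.Ioo 0 (π / 2) ∧ (∀ k ∈ Set.Ioo 0 (π / 2), deriv h k = 0 ↔ k = k₀) ∧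
      (0 < a * b → h k₀ = 2 * |b|) ∧ (a * b < 0 → h k₀ = -(2 * |b|)) := by
  have ha : a ≠ 0 := abs_pos.1 ((abs_nonneg b).trans_lt hab)
  have hlt : |b / a| < 1 := by
    rw [abs_div]; exact (div_lt_one (abs_pos.2 ha)).2 hab
  obtain ⟨hl, hu⟩ := abs_lt.1 hlt
  have h2k : 2 * k₀ = arccos (-(b / a)) := by rw [hk₀]; ring
  have hcos : cos (2 * k₀) = -(b / a) := by
    rw [h2k, cos_arccos (by linarith) (by linarith)]
  have hpos : 0 < arccos (-(b / a)) := arccos_pos.2 (by linarith)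
  have hltpi : arccos (-(b / a)) < π := by
    rw [arccos_neg]; linarith [arccos_pos.2 hu]
  have hmem : k₀ ∈ Set.Ioo 0 (π / 2) := ⟨by linarith, by linarith⟩
  have hsin : 0 < sin (2 * k₀) := sin_pos_of_pos_of_lt_pi (by linarith) (by linarith)
  have hval : h k₀ = 2 * (a * b) / |a| := by
    have hsc := sin_sq_add_cos_sq (2 * k₀)
    have hac : a * cos (2 * k₀) = -b := by rw [hcos]; field_simp
    have hg : a ^ 2 + b ^ 2 + 2 * a * b * cos (2 * k₀) = (a * sin (2 * k₀)) ^ 2 := by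
      linear_combination (b + a * cos (2 * k₀)) * hac - a ^ 2 * hsc
    rw [hh, hg, sqrt_sq_eq_abs, abs_mul, abs_of_pos hsin]
    have := abs_pos.2 ha
    field_simp
  refine ⟨hmem, fun k hk => ?_, fun hp => ?_, fun hn => ?_⟩
  · rw [funext hh, deriv_sin_div_sqrt_eq_zero_iff hb hab, ← hcos]
    refine ⟨fun heq => ?_, fun heq => by rw [heq]⟩
    have := injOn_cos ⟨by linarith [hk.1], by linarith [hk.2]⟩
      ⟨by linarith [hmem.1], by linarith [hmem.2]⟩ heq
    linarith
  · rw [hval, ← abs_of_pos hp, abs_mul]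
    field_simp
  · rw [hval, ← neg_neg (a * b), ← abs_of_neg hn, abs_mul]
    field_simp

/-- The critical point `k* ∈ (0, π/2)` is the unique zero of `h'` in `(0, π/2)`, and
`h(k*) = 2|γ_ξ|` if `γ₀γ₁ > 0`, while `h(k*) = -2|γ_ξ|` if `γ₀γ₁ < 0`. -/
theorem stmt_8 (γ₀ γ₁ : ℝ) (hγ₀ : γ₀ ≠ 0) (hγ₁ : γ₁ ≠ 0) (hne : |γ₀| ≠ |γ₁|)
    (g : ℝ → ℝ) (hg : ∀ k, g k = γ₀ ^ 2 + γ₁ ^ 2 + 2 * γ₀ * γ₁ * Real.cos (2 * k))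
    (h : ℝ → ℝ) (hh : ∀ k, h k = 2 * γ₀ * γ₁ * Real.sin (2 * k) / Real.sqrt (g k))
    (kstar : ℝ)
    (hks₁ : |γ₀| > |γ₁| → kstar = (1 / 2) * Real.arccos (-(γ₁ / γ₀)))
    (hks₂ : |γ₀| < |γ₁| → kstar = (1 / 2) * Real.arccos (-(γ₀ / γ₁)))
    (γξ : ℝ) (hξ : γξ = γ₀ ∨ γξ = γ₁) (hmin : |γξ| = min |γ₀| |γ₁|) :
    kstar ∈ Set.Ioo 0 (π / 2) ∧
    (∀ k ∈ Set.Ioo 0 (π / 2), deriv h k = 0 ↔ k = kstar) ∧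
    (γ₀ * γ₁ > 0 → h kstar = 2 * |γξ|) ∧
    (γ₀ * γ₁ < 0 → h kstar = -(2 * |γξ|)) := by
  rcases lt_or_gt_of_ne hne with hlt | hgt
  · rw [hmin, min_eq_left hlt.le, mul_comm γ₀ γ₁]
    refine half_arccos_critical hγ₀ hlt (hks₂ hlt) fun k => ?_
    rw [hh, hg, mul_right_comm 2 γ₀ γ₁, add_comm (γ₀ ^ 2)]
  · rw [hmin, min_eq_right hgt.le]
    refine half_arccos_critical hγ₁ hgt (hks₁ hgt) fun k => ?_
    rw [hh, hg]
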